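/- arXiv:math/0407463 — 5 statements merged into one kernel-verified Lean document; each statement's English description precedes it below -/
import Mathlib

section
/- Let (E, G, ∂, •) be a crossed module, let ξ, ψ, χ : E → ℂˣ be group characters, and let h₁ : G → GL(Fin n₁, ℂ) and h₂ : G → GL(Fin n₂, ℂ) be group homomorphisms satisfying h₁(∂ e) = (ξ(e)⁻¹ ψ(e)) · 1 and h₂(∂ e) = (ψ(e)⁻¹ χ(e)) · 1 for all e ∈ E. Then the map X ↦ h₁(X) ⊗ h₂(X) (Kronecker product of matrices, an invertible (n₁ n₂) × (n₁ n₂) complex matrix) is a group homomorphism from G to GL(n₁ n₂, ℂ) and satisfies (h₁ ⊗ h₂)(∂ e) = (ξ(e)⁻¹ χ(e)) · 1 for all e ∈ E. (This is the claim in the theorem on categorical characters that the composition of two 1-intertwiners between one-dimensional categorical representations corresponds to the tensor product of the two respective representations of G.) -/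
open scoped Kronecker

/-- The composition of two 1-intertwiners between one-dimensional
categorical representations corresponds to the Kronecker (tensor) product of
the corresponding representations of G: X ↦ h₁(X) ⊗ h₂(X) is a group
homomorphism G → GL(n₁n₂, ℂ) and intertwines ξ with χ. -/
theorem composition_of_one_dim_intertwiners_is_kronecker
    {E G : Type*} [Group E] [Group G]
    (δ : E →* G) (act : G →* MulAut E)
    (equivariance : ∀ (X : G) (e : E), δ (act X e) = X * δ e * X⁻¹)
    (peiffer : ∀ e e' : E, act (δ e) e' = e * e' * e⁻¹)
    (ξ ψ χ : E →* ℂˣ) (n₁ n₂ : ℕ)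
    (h₁ : G →* Matrix.GeneralLinearGroup (Fin n₁) ℂ)
    (h₂ : G →* Matrix.GeneralLinearGroup (Fin n₂) ℂ)
    (hint₁ : ∀ e : E, (h₁ (δ e) : Matrix (Fin n₁) (Fin n₁) ℂ)
      = (((ξ e)⁻¹ * ψ e : ℂˣ) : ℂ) • (1 : Matrix (Fin n₁) (Fin n₁) ℂ))
    (hint₂ : ∀ e : E, (h₂ (δ e) : Matrix (Fin n₂) (Fin n₂) ℂ)
      = (((ψ e)⁻¹ * χ e : ℂˣ) : ℂ) • (1 : Matrix (Fin n₂) (Fin n₂) ℂ)) :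
    ∃ k : G →* Matrix.GeneralLinearGroup (Fin n₁ × Fin n₂) ℂ,
      (∀ X : G, (k X : Matrix (Fin n₁ × Fin n₂) (Fin n₁ × Fin n₂) ℂ)
        = (h₁ X : Matrix (Fin n₁) (Fin n₁) ℂ) ⊗ₖ (h₂ X : Matrix (Fin n₂) (Fin n₂) ℂ)) ∧
      (∀ e : E, (k (δ e) : Matrix (Fin n₁ × Fin n₂) (Fin n₁ × Fin n₂) ℂ)
        = (((ξ e)⁻¹ * χ e : ℂˣ) : ℂ) • (1 : Matrix (Fin n₁ × Fin n₂) (Fin n₁ × Fin n₂) ℂ)) := by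
  refine ⟨MonoidHom.toHomUnits
    { toFun := fun X => (h₁ X : Matrix (Fin n₁) (Fin n₁) ℂ) ⊗ₖ (h₂ X : Matrix (Fin n₂) (Fin n₂) ℂ)
      map_one' := by simp
      map_mul' := fun X Y => by simp [Matrix.mul_kronecker_mul] }, fun X => rfl, fun e => ?_⟩
  change (h₁ (δ e) : Matrix (Fin n₁) (Fin n₁) ℂ) ⊗ₖ (h₂ (δ e) : Matrix (Fin n₂) (Fin n₂) ℂ) = _
  rw [hint₁, hint₂, Matrix.smul_kronecker, Matrix.kronecker_smul, Matrix.one_kronecker_one,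
    smul_smul, ← Units.val_mul]
  congr 2
  group
end

section
/- Let (E, G, ∂, •) be a crossed module, N, M natural numbers, and ρ : G → Perm(Fin N), τ : G → Perm(Fin M) group homomorphisms with ρ(∂ e) = 1 and τ(∂ e) = 1 for all e ∈ E. Let ξ : Fin N → (E → ℂˣ) and ψ : Fin M → (E → ℂˣ) be families of group characters, let d : Fin N → Fin M → ℕ satisfy d(ρ(X)⁻¹ i, j) = d(i, τ(X) j) for all X ∈ G, i, j, and for each X ∈ G and each pair (i, j) let θ(X)^i_j : ℂ^{d(ρ(X)⁻¹ i, j)} → ℂ^{d(i, τ(X) j)} be an invertible linear map. Assume: (i) θ(1)^i_j is the identity for all i, j; (ii) the coherence (left-action) condition θ(X Y)^i_j = θ(X)^i_{τ(Y) j} ∘ θ(Y)^{ρ(X)⁻¹ i}_j holds for all X, Y ∈ G, i, j; (iii) the restricted naturality condition ξ_i(e) · θ(∂ e)^i_j = ψ_j(e) · id holds on ℂ^{d(i,j)} for all e ∈ E, i, j (note θ(∂ e)^i_j is an endomorphism of ℂ^{d(i,j)} since ρ(∂ e) = τ(∂ e) = 1). Then the full naturality condition holds: for all X ∈ G, e ∈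 E, i, j, one has ξ_{ρ(X)⁻¹ i}(e) · θ(X ∂ e)^i_j = ψ_j(e) · θ(X)^i_j (both sides are maps ℂ^{d(ρ(X)⁻¹ i, j)} → ℂ^{d(i, τ(X) j)}). (This is the paper's lemma that for 1-intertwiners of strict categorical representations, the naturality condition for all morphisms follows from its restriction to morphisms with source 1 together with the coherence condition of a natural 2-transformation.) -/
/-- Reindexing ("identity") linear map between coordinate spaces of equal
dimension, used to identify the fibres ℂ^a and ℂ^b when a = b. -/
noncomputable def castL {a b : ℕ} (h : a = b) : (Fin a → ℂ) →ₗ[ℂ] (Fin b → ℂ) :=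
  LinearMap.funLeft ℂ ℂ (Fin.cast h.symm)

theorem castL_rfl {a : ℕ} : castL (rfl : a = a) = LinearMap.id := rfl

theorem castL_comp_castL {a b c : ℕ} (h : b = c) (h' : a = b) :
    castL h ∘ₗ castL h' = castL (h'.trans h) := by
  subst h h'
  rfl

/-- A family of linear maps between coordinate spaces commutes with reindexing along an
equality of parameters. -/
theorem castL_comp_family_comp_castL {ι : Type*} {a b : ι → ℕ}
    (f : ∀ k, (Fin (a k) → ℂ) →ₗ[ℂ] (Fin (b k) → ℂ)) {k l : ι} (h : k = l)
    (hb : b k = b l) (ha : a l = a k) :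
    castL hb ∘ₗ f k ∘ₗ castL ha = f l := by
  subst h
  rw [castL_rfl, castL_rfl, LinearMap.id_comp, LinearMap.comp_id]

/-- For 1-intertwiners of strict categorical representations, the
full naturality condition follows from its restriction to morphisms with
source 1 together with the coherence condition of a natural
2-transformation. -/
theorem naturality_from_restricted_naturality
    {E G : Type*} [Group E] [Group G]
    (δ : E →* G) (act : G →* MulAut E)
    (equivariance : ∀ (X : G) (e : E), δ (act X e) = X * δ e * X⁻¹)
    (peiffer : ∀ e e' : E, act (δ e) e' = e * e' * e⁻¹)
    {N M : ℕ}
    (ρ : G →* Equiv.Perm (Fin N)) (τ : G →* Equiv.Perm (Fin M))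
    (hρ : ∀ e : E, ρ (δ e) = 1) (hτ : ∀ e : E, τ (δ e) = 1)
    (ξ : Fin N → (E →* ℂˣ)) (ψ : Fin M → (E →* ℂˣ))
    (d : Fin N → Fin M → ℕ)
    (hd : ∀ (X : G) (i : Fin N) (j : Fin M), d ((ρ X)⁻¹ i) j = d i (τ X j))
    (θ : ∀ (X : G) (i : Fin N) (j : Fin M),
      (Fin (d ((ρ X)⁻¹ i) j) → ℂ) →ₗ[ℂ] (Fin (d i (τ X j)) → ℂ))
    (hinv : ∀ (X : G) (i : Fin N) (j : Fin M), Function.Bijective (θ X i j))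
    -- (i) θ(1) is the identity (modulo the canonical identification of fibres)
    (hone : ∀ (i : Fin N) (j : Fin M),
      θ 1 i j = castL (show d ((ρ 1)⁻¹ i) j = d i (τ 1 j) by simp))
    -- (ii) coherence (left-action) condition
    (hcomp : ∀ (X Y : G) (i : Fin N) (j : Fin M),
      θ (X * Y) i j =
        castL (show d i (τ X (τ Y j)) = d i (τ (X * Y) j) by rw [map_mul]; rfl) ∘ₗ
        θ X i (τ Y j) ∘ₗ θ Y ((ρ X)⁻¹ i) j ∘ₗ
        castL (show d ((ρ (X * Y))⁻¹ i) j = d ((ρ Y)⁻¹ ((ρ X)⁻¹ i)) j by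
          rw [map_mul, mul_inv_rev]; rfl))
    -- (iii) restricted naturality condition, for morphisms with source 1
    (hrest : ∀ (e : E) (i : Fin N) (j : Fin M),
      ((ξ i e : ℂˣ) : ℂ) • θ (δ e) i j =
        ((ψ j e : ℂˣ) : ℂ) •
          castL (show d ((ρ (δ e))⁻¹ i) j = d i (τ (δ e) j) by rw [hρ, hτ]; simp)) :
    -- full naturality
    ∀ (X : G) (e : E) (i : Fin N) (j : Fin M),
      ((ξ ((ρ X)⁻¹ i) e : ℂˣ) : ℂ) •
        (castL (show d i (τ (X * δ e) j) = d i (τ X j) by rw [map_mul, hτ, mul_one]) ∘ₗ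
         θ (X * δ e) i j ∘ₗ
         castL (show d ((ρ X)⁻¹ i) j = d ((ρ (X * δ e))⁻¹ i) j by
           rw [map_mul, hρ, mul_one])) =
      ((ψ j e : ℂˣ) : ℂ) • θ X i j := by
  intro X e i j
  rw [hcomp X (δ e) i j]
  simp only [LinearMap.comp_assoc, castL_comp_castL]
  rw [← LinearMap.comp_smul, ← LinearMap.comp_smul, ← LinearMap.comp_smul,
    ← LinearMap.smul_comp, hrest, LinearMap.smul_comp, LinearMap.comp_smul,
    LinearMap.comp_smul, LinearMap.comp_smul, castL_comp_castL, ← LinearMap.comp_assoc,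
    castL_comp_castL,
    castL_comp_family_comp_castL (θ X i) (show τ (δ e) j = j by rw [hτ]; rfl)]
end

section
/- Let (E, G, ∂, •) be a crossed module, N ≥ 1, and let R_b : G → Perm(Fin N) be a group homomorphism with R_b(∂ e) = 1 for all e ∈ E, such that the induced action of G on Fin N is transitive. Suppose ξ, ξ' : Fin N → (E → ℂˣ) are two families of group characters each satisfying the compatibility condition ξ_i(X • e) = ξ_{R_b(X)⁻¹ i}(e) (respectively ξ'_i(X • e) = ξ'_{R_b(X)⁻¹ i}(e)) for all i, X, e, and that ξ_{i₀} = ξ'_{i₀} for some index i₀. Then ξ_i = ξ'_i for all i ∈ Fin N. (This is the paper's lemma that an indecomposable categorical representation is completely determined by R_b and just one character on E.) -/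
/-- An indecomposable (i.e. transitive) categorical
representation is completely determined by R_b and one character: if two
compatible families of characters agree at one index, they agree
everywhere. -/
theorem indecomposable_rep_determined_by_one_character
    {E G : Type*} [Group E] [Group G]
    (δ : E →* G) (act : G →* MulAut E)
    (equivariance : ∀ (X : G) (e : E), δ (act X e) = X * δ e * X⁻¹)
    (peiffer : ∀ e e' : E, act (δ e) e' = e * e' * e⁻¹)
    {N : ℕ} (hN : 1 ≤ N)
    (Rb : G →* Equiv.Perm (Fin N))
    (hker : ∀ e : E, Rb (δ e) = 1)
    (htrans : ∀ i j : Fin N, ∃ X : G, Rb X i = j)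
    (ξ ξ' : Fin N → (E →* ℂˣ))
    (hξ : ∀ (i : Fin N) (X : G) (e : E), ξ i (act X e) = ξ ((Rb X)⁻¹ i) e)
    (hξ' : ∀ (i : Fin N) (X : G) (e : E), ξ' i (act X e) = ξ' ((Rb X)⁻¹ i) e)
    (i₀ : Fin N) (h₀ : ξ i₀ = ξ' i₀) :
    ∀ i : Fin N, ξ i = ξ' i := by
  intro i
  obtain ⟨X, rfl⟩ := htrans i i₀
  ext e
  have h : ξ (Rb X i) (act X e) = ξ' (Rb X i) (act X e) := by rw [h₀]
  simp only [hξ, hξ', ← Equiv.Perm.mul_apply, inv_mul_cancel, Equiv.Perm.one_apply] at h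
  rw [h]
end

section
/- Let (E, G, ∂, •) be a crossed module, N ≥ 1, and let (R_b, ξ) be an N-dimensional strict categorical representation: R_b : G → Perm(Fin N) a group homomorphism with R_b(∂ e) = 1 for all e, and ξ : Fin N → (E → ℂˣ) a family of group characters with ξ_i(X • e) = ξ_{R_b(X)⁻¹ i}(e) for all i, X, e. Then the induced action of G on Fin N is transitive if and only if the representation is not decomposable, where 'decomposable' means: there exist K with 0 < K < N, a bijection c : Fin N ≃ Fin K ⊕ Fin (N−K), group homomorphisms ρ₁ : G → Perm(Fin K) and ρ₂ : G → Perm(Fin (N−K)) with ρ₁(∂e) = 1 and ρ₂(∂e) = 1, and families of characters ξ¹ : Fin K → (E → ℂˣ) and ξ² : Fin (N−K) → (E → ℂˣ) each satisfying the corresponding compatibility condition, such that for all X ∈ G the permutation c ∘ R_b(X) ∘ c⁻¹ of Fin K ⊕ Fin (N−K) equals the sum ρ₁(X) ⊕ ρ₂(X) (Equiv.sumCongr), and the family ξ transported along c equals the family given by ξ¹ on the left summand and ξ² on the right summand. (This is the paper's lemma that an N-dimensional categorical representation is indecomposable if and only if the action of R_b(G) on {1, …, N} is transitive.) -/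
/-- A homomorphism into the permutations of a finite sum type that preserves the left summand
splits as a sum of homomorphisms into the permutations of the summands. -/
theorem exists_monoidHom_sumCongr_of_mapsTo_inl {G A B : Type*} [Group G] [Finite A] [Finite B]
    (f : G →* Equiv.Perm (A ⊕ B))
    (hf : ∀ X, Set.MapsTo (f X) (Set.range Sum.inl) (Set.range Sum.inl)) :
    ∃ (ρ₁ : G →* Equiv.Perm A) (ρ₂ : G →* Equiv.Perm B),
      ∀ X, f X = Equiv.sumCongr (ρ₁ X) (ρ₂ X) := by
  let f' : G →* (Equiv.Perm.sumCongrHom A B).range :=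
    f.codRestrict _ fun X => Equiv.Perm.mem_sumCongrHom_range_of_perm_mapsTo_inl (hf X)
  let g : G →* Equiv.Perm A × Equiv.Perm B :=
    (MonoidHom.ofInjective
      (Equiv.Perm.sumCongrHom_injective (α := A) (β := B))).symm.toMonoidHom.comp f'
  have hg (X : G) : Equiv.Perm.sumCongrHom A B (g X) = f X :=
    congrArg Subtype.val ((MonoidHom.ofInjective
      (Equiv.Perm.sumCongrHom_injective (α := A) (β := B))).apply_symm_apply (f' X))
  exact ⟨(MonoidHom.fst _ _).comp g, (MonoidHom.snd _ _).comp g, fun X => (hg X).symm⟩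

/-- A subset of `Fin N` with `K` elements is carried to the left summand by some bijection
`Fin N ≃ Fin K ⊕ Fin (N - K)`. -/
theorem exists_equiv_sum_mem_iff_mem_range_inl {N K : ℕ} (S : Set (Fin N))
    (hK : Nat.card S = K) :
    ∃ c : Fin N ≃ Fin K ⊕ Fin (N - K),
      ∀ j, j ∈ S ↔ c j ∈ Set.range Sum.inl := by
  classical
  have hcompl : Nat.card {j // j ∉ S} = N - K := by
    have h := Nat.card_congr (Equiv.sumCompl (· ∈ S))
    rw [Nat.card_sum, Nat.card_fin] at h
    exact Nat.eq_sub_of_add_eq' (hK ▸ h)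
  refine ⟨(Equiv.sumCompl (· ∈ S)).symm.trans
    (Equiv.sumCongr (Finite.equivFinOfCardEq hK) (Finite.equivFinOfCardEq hcompl)), fun j => ?_⟩
  by_cases hj : j ∈ S
  · simp [hj, Equiv.sumCompl_symm_apply_of_pos]
  · simp [hj, Equiv.sumCompl_symm_apply_of_neg]

/-- An N-dimensional strict categorical representation is
indecomposable if and only if the action of R_b(G) on Fin N is transitive. -/
theorem indecomposable_iff_transitive
    {E G : Type*} [Group E] [Group G]
    (δ : E →* G) (act : G →* MulAut E)
    (equivariance : ∀ (X : G) (e : E), δ (act X e) = X * δ e * X⁻¹)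
    (peiffer : ∀ e e' : E, act (δ e) e' = e * e' * e⁻¹)
    {N : ℕ} (hN : 1 ≤ N)
    (Rb : G →* Equiv.Perm (Fin N))
    (hker : ∀ e : E, Rb (δ e) = 1)
    (ξ : Fin N → (E →* ℂˣ))
    (hξ : ∀ (i : Fin N) (X : G) (e : E), ξ i (act X e) = ξ ((Rb X)⁻¹ i) e) :
    (∀ i j : Fin N, ∃ X : G, Rb X i = j) ↔
    ¬ (∃ (K : ℕ), 0 < K ∧ K < N ∧
        ∃ (c : Fin N ≃ (Fin K ⊕ Fin (N - K)))
          (ρ₁ : G →* Equiv.Perm (Fin K))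
          (ρ₂ : G →* Equiv.Perm (Fin (N - K)))
          (ξ₁ : Fin K → (E →* ℂˣ))
          (ξ₂ : Fin (N - K) → (E →* ℂˣ)),
          (∀ e : E, ρ₁ (δ e) = 1) ∧
          (∀ e : E, ρ₂ (δ e) = 1) ∧
          (∀ (i : Fin K) (X : G) (e : E), ξ₁ i (act X e) = ξ₁ ((ρ₁ X)⁻¹ i) e) ∧
          (∀ (i : Fin (N - K)) (X : G) (e : E), ξ₂ i (act X e) = ξ₂ ((ρ₂ X)⁻¹ i) e) ∧
          (∀ X : G, (c.symm.trans ((Rb X).trans c)) = Equiv.sumCongr (ρ₁ X) (ρ₂ X)) ∧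
          (∀ i : Fin K, ξ (c.symm (Sum.inl i)) = ξ₁ i) ∧
          (∀ i : Fin (N - K), ξ (c.symm (Sum.inr i)) = ξ₂ i)) := by
  constructor
  · rintro htrans ⟨K, hK, hKN, c, ρ₁, ρ₂, _, _, -, -, -, -, hc, -⟩
    obtain ⟨X, hX⟩ := htrans (c.symm (Sum.inl ⟨0, hK⟩))
      (c.symm (Sum.inr ⟨0, Nat.sub_pos_of_lt hKN⟩))
    have h := DFunLike.congr_fun (hc X) (Sum.inl ⟨0, hK⟩)
    simp [hX] at h
  · intro hindec
    by_contra! hnot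
    obtain ⟨i, j, hij⟩ := hnot
    apply hindec
    let S : Set (Fin N) := {k | ∃ X, Rb X i = k}
    have hiS : i ∈ S := ⟨1, by simp⟩
    have hjS : j ∉ S := fun ⟨X, hX⟩ => hij X hX
    have hS (X : G) {k : Fin N} (hk : k ∈ S) : Rb X k ∈ S := by
      obtain ⟨Y, rfl⟩ := hk
      exact ⟨X * Y, by simp⟩
    obtain ⟨K, hK⟩ : ∃ K, Nat.card S = K := ⟨_, rfl⟩
    obtain ⟨c, hc⟩ := exists_equiv_sum_mem_iff_mem_range_inl S hK
    obtain ⟨ρ₁, ρ₂, hρ⟩ := exists_monoidHom_sumCongr_of_mapsTo_inl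
      (c.permCongrHom.toMonoidHom.comp Rb) fun X x hx =>
        (hc _).1 (hS X ((hc (c.symm x)).2 (by simpa using hx)))
    have hinl (X : G) (k) : Rb X (c.symm (Sum.inl k)) = c.symm (Sum.inl (ρ₁ X k)) :=
      c.injective (by simpa using DFunLike.congr_fun (hρ X) (Sum.inl k))
    have hinr (X : G) (k) : Rb X (c.symm (Sum.inr k)) = c.symm (Sum.inr (ρ₂ X k)) :=
      c.injective (by simpa using DFunLike.congr_fun (hρ X) (Sum.inr k))
    refine ⟨K, ?_, ?_, c, ρ₁, ρ₂, fun k => ξ (c.symm (Sum.inl k)),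
      fun k => ξ (c.symm (Sum.inr k)), fun e => ?_, fun e => ?_, fun k X e => ?_,
      fun k X e => ?_, hρ, fun _ => rfl, fun _ => rfl⟩
    · have : Nonempty S := ⟨⟨i, hiS⟩⟩
      exact hK ▸ Nat.card_pos
    · simpa [← hK] using Finite.card_subtype_lt hjS
    · ext1 k
      simpa [hker] using (hinl (δ e) k).symm
    · ext1 k
      simpa [hker] using (hinr (δ e) k).symm
    · simp only [hξ, ← map_inv, hinl]
    · simp only [hξ, ← map_inv, hinr]
end

section
/- There exists a permutation σ of Fin 4, with 4 × 4 complex permutation matrix P, such that for all a, b ∈ ℂˣ the following two conjugation identities hold simultaneously (under the standard identification Fin 2 × Fin 2 ≃ Fin 4 of Kronecker-product indices): P * (D(a) ⊗ D(b)) * P⁻¹ equals the block-diagonal matrix with blocks D(a b) and D(a b⁻¹), and P * (S ⊗ S) * P⁻¹ equals the block-diagonal matrix with blocks S and S; here D(c) denotes the 2 × 2 diagonal matrix with diagonal entries c, c⁻¹, S denotes the 2 × 2 matrix with entries 0 on the diagonal and 1 off the diagonal, and ⊗ is the Kronecker product. (This is the paper's explicit computation showing that the monoidal product of categorical representations decomposes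 as 𝒱(2)_ξ ⊠ 𝒱(2)_ψ ≅ 𝒱(2)_{ξψ} ⊞ 𝒱(2)_{ξψ⁻¹}, realized by an invertible 1-intertwiner whose underlying 1-morphism is a permutation matrix.) -/
open scoped Kronecker

/-- The 2 × 2 diagonal matrix diag(c, c⁻¹), the image of the morphism x
under the categorical representation 𝒱(2)_ξ with ξ(x) = c. -/
noncomputable def Dmat (c : ℂˣ) : Matrix (Fin 2) (Fin 2) ℂ :=
  !![(c : ℂ), 0; 0, ((c⁻¹ : ℂˣ) : ℂ)]

/-- The 2 × 2 swap matrix. -/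
def Smat : Matrix (Fin 2) (Fin 2) ℂ := !![0, 1; 1, 0]

/-- Conjugation by the permutation matrix of `σ` reindexes rows and columns by `σ`. -/
theorem permMatrix_mul_mul_inv {n R : Type*} [Fintype n] [DecidableEq n] [CommRing R]
    (σ : Equiv.Perm n) (M : Matrix n n R) :
    σ.permMatrix R * M * (σ.permMatrix R)⁻¹ = M.submatrix σ σ := by
  have hinv : (σ.permMatrix R)⁻¹ = (σ⁻¹).permMatrix R :=
    Matrix.inv_eq_right_inv (by rw [← Matrix.permMatrix_mul, inv_mul_cancel, Matrix.permMatrix_one])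
  rw [hinv, Equiv.Perm.permMatrix, Equiv.Perm.permMatrix, PEquiv.toMatrix_toPEquiv_mul,
    PEquiv.mul_toMatrix_toPEquiv]
  rfl

/-- The `3`-cycle `1 ↦ 3 ↦ 2 ↦ 1` of `Fin 4`. -/
def blockPerm : Equiv.Perm (Fin 4) where
  toFun := ![0, 3, 1, 2]
  invFun := ![0, 2, 3, 1]
  left_inv := by decide
  right_inv := by decide

/-- There is a permutation σ of Fin 4 whose permutation matrix P
conjugates, for all a b : ℂˣ, the Kronecker products D(a) ⊗ D(b) and S ⊗ S
simultaneously to the block-diagonal matrices diag(D(ab), D(ab⁻¹)) and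
diag(S, S); i.e. 𝒱(2)_ξ ⊠ 𝒱(2)_ψ ≅ 𝒱(2)_{ξψ} ⊞ 𝒱(2)_{ξψ⁻¹}. -/
theorem V2_tensor_decomposition :
    ∃ σ : Equiv.Perm (Fin 4),
      ∀ a b : ℂˣ,
        (σ.permMatrix ℂ) *
            (Matrix.reindex finProdFinEquiv finProdFinEquiv (Dmat a ⊗ₖ Dmat b)) *
            (σ.permMatrix ℂ)⁻¹ =
          Matrix.reindex finSumFinEquiv finSumFinEquiv
            (Matrix.fromBlocks (Dmat (a * b)) 0 0 (Dmat (a * b⁻¹))) ∧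
        (σ.permMatrix ℂ) *
            (Matrix.reindex finProdFinEquiv finProdFinEquiv (Smat ⊗ₖ Smat)) *
            (σ.permMatrix ℂ)⁻¹ =
          Matrix.reindex finSumFinEquiv finSumFinEquiv
            (Matrix.fromBlocks Smat 0 0 Smat) := by
  refine ⟨blockPerm, fun a b => ?_⟩
  rw [permMatrix_mul_mul_inv, permMatrix_mul_mul_inv]
  constructor <;> ext i j <;> fin_cases i <;> fin_cases j <;>
    simp [blockPerm, Dmat, Smat, finProdFinEquiv, finSumFinEquiv, Fin.divNat, Fin.modNat,
      Fin.addCases, mul_comm]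
end
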